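/- arXiv:2012.05656 — 8 statements merged into one kernel-verified Lean document; each statement's English description precedes it below -/
import Mathlib

section
/- Let G = (V, E) be a finite simple graph and w ∈ V. Then every minimum hull set of G (in the cycle convexity) contains w if, and only if, the singleton {w} is a co-convex set of G. -/
open SimpleGraph

/-- The cycle-convexity interval function: `Icc G S` adds to `S` every vertex `v`
lying on a cycle of the subgraph of `G` induced by `S ∪ {v}`. -/
def Icc {V : Type*} (G : SimpleGraph V) (S : Set V) : Set V :=
  S ∪ {v | ∃ w : (G.induce (insert v S)).Walk ⟨v, Set.mem_insert v S⟩ ⟨v, Set.mem_insert v S⟩,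
        w.IsCycle}

/-- A set is convex in the cycle convexity if it is `Icc`-closed. -/
def CcConvex {V : Type*} (G : SimpleGraph V) (S : Set V) : Prop := Icc G S = S

/-- The convex hull of `S` in the cycle convexity: the smallest convex set containing `S`. -/
def ccHull {V : Type*} (G : SimpleGraph V) (S : Set V) : Set V :=
  ⋂₀ {T : Set V | S ⊆ T ∧ CcConvex G T}

/-- A hull set in the cycle convexity. -/
def IsHullSet {V : Type*} (G : SimpleGraph V) (S : Set V) : Prop := ccHull G S = Set.univ

/-- The hull number in the cycle convexity: minimum cardinality of a hull set. -/
noncomputable def hnCC {V : Type*} (G : SimpleGraph V) : ℕ :=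
  sInf {n | ∃ S : Set V, S.ncard = n ∧ IsHullSet G S}

section CycleConvexity

variable {V : Type*} {G : SimpleGraph V} {S T : Set V} {v w : V}

/-- Membership in the interval, in terms of cycles of the ambient graph. -/
theorem mem_Icc_iff_exists_isCycle :
    v ∈ Icc G S ↔ v ∈ S ∨ ∃ p : G.Walk v v, p.IsCycle ∧ ∀ x ∈ p.support, x ∈ insert v S := by
  refine or_congr Iff.rfl ⟨?_, ?_⟩
  · rintro ⟨p, hp⟩
    refine ⟨p.map (Embedding.induce _).toHom,
      hp.map (Embedding.induce (G := G) (insert v S)).injective, ?_⟩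
    intro x hx
    have hsupp := Walk.support_map (Embedding.induce (G := G) (insert v S)).toHom p
    obtain ⟨y, -, rfl⟩ := List.mem_map.1 (hsupp ▸ hx)
    exact y.2
  · rintro ⟨p, hp, hpS⟩
    refine ⟨p.induce _ hpS, Walk.IsCycle.of_map (f := (Embedding.induce _).toHom) ?_⟩
    rwa [Walk.map_induce]

theorem ccConvex_iff_forall_isCycle :
    CcConvex G S ↔
      ∀ v, ∀ p : G.Walk v v, p.IsCycle → (∀ x ∈ p.support, x ∈ insert v S) → v ∈ S := by
  constructor
  · intro h v p hp hpS
    rw [← h]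
    exact mem_Icc_iff_exists_isCycle.2 (.inr ⟨p, hp, hpS⟩)
  · refine fun h ↦ Set.Subset.antisymm (fun v hv ↦ ?_) Set.subset_union_left
    obtain hv | ⟨p, hp, hpS⟩ := mem_Icc_iff_exists_isCycle.1 hv
    exacts [hv, h v p hp hpS]

theorem subset_ccHull : S ⊆ ccHull G S := Set.subset_sInter fun _ h ↦ h.1

theorem ccHull_subset (h : S ⊆ T) (hT : CcConvex G T) : ccHull G S ⊆ T :=
  Set.sInter_subset_of_mem ⟨h, hT⟩

theorem ccConvex_ccHull : CcConvex G (ccHull G S) := by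
  refine ccConvex_iff_forall_isCycle.2 fun v p hp hpS T hT ↦ ?_
  exact ccConvex_iff_forall_isCycle.1 hT.2 v p hp fun x hx ↦
    Set.insert_subset_insert (Set.sInter_subset_of_mem hT) (hpS x hx)

theorem ccHull_mono (h : S ⊆ T) : ccHull G S ⊆ ccHull G T :=
  ccHull_subset (h.trans subset_ccHull) ccConvex_ccHull

theorem exists_isHullSet_ncard_eq_hnCC : ∃ S : Set V, S.ncard = hnCC G ∧ IsHullSet G S :=
  Nat.sInf_mem (s := {n | ∃ S : Set V, S.ncard = n ∧ IsHullSet G S})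
    ⟨_, Set.univ, rfl, Set.univ_subset_iff.1 subset_ccHull⟩

theorem IsHullSet.hnCC_le_ncard (h : IsHullSet G S) : hnCC G ≤ S.ncard :=
  Nat.sInf_le ⟨S, rfl, h⟩

theorem IsHullSet.mem_of_ccConvex_compl_singleton (hS : IsHullSet G S)
    (h : CcConvex G (Set.univ \ {w})) : w ∈ S := by
  by_contra hw
  have hw' : w ∈ ccHull G S := hS ▸ Set.mem_univ w
  have hsub : S ⊆ Set.univ \ {w} := fun x hx ↦ ⟨trivial, fun hxw ↦ hw (hxw ▸ hx)⟩
  exact (ccHull_subset hsub h hw').2 rfl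

/-- A vertex that lies on a cycle of `G` can be exchanged in a hull set for another vertex
outside the hull of the remaining ones. -/
theorem IsHullSet.exists_exchange (hS : IsHullSet G S)
    (hw : ¬ CcConvex G (Set.univ \ {w})) (hwT : w ∉ ccHull G (S \ {w})) :
    ∃ u, u ≠ w ∧ u ∉ ccHull G (S \ {w}) ∧ IsHullSet G (insert u (S \ {w})) := by
  have hT := ccConvex_iff_forall_isCycle.1 (ccConvex_ccHull (G := G) (S := S \ {w}))
  have hsub : S ⊆ insert w (ccHull G (S \ {w})) := fun x hx ↦ by
    by_cases hxw : x = w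
    · exact .inl hxw
    · exact .inr (subset_ccHull ⟨hx, hxw⟩)
  have hnc : ¬ CcConvex G (insert w (ccHull G (S \ {w}))) := by
    intro hc
    have huniv : insert w (ccHull G (S \ {w})) = Set.univ :=
      Set.univ_subset_iff.1 (hS ▸ ccHull_subset hsub hc)
    refine hw (ccConvex_iff_forall_isCycle.2 fun v p hp _ ↦ ⟨trivial, ?_⟩)
    rintro rfl
    exact hwT (hT v p hp fun x _ ↦ huniv ▸ Set.mem_univ x)
  rw [ccConvex_iff_forall_isCycle] at hnc
  push Not at hnc
  obtain ⟨u, p, hp, hpS, hu⟩ := hnc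
  rw [Set.mem_insert_iff, not_or] at hu
  refine ⟨u, hu.1, hu.2, ?_⟩
  have hwp : w ∈ p.support := by
    by_contra hwp
    refine hu.2 (hT u p hp fun x hx ↦ ?_)
    obtain h | rfl | h := hpS x hx
    exacts [.inl h, (hwp hx).elim, .inr h]
  have hle : ccHull G (S \ {w}) ⊆ ccHull G (insert u (S \ {w})) :=
    ccHull_mono (Set.subset_insert _ _)
  have huH : u ∈ ccHull G (insert u (S \ {w})) := subset_ccHull (Set.mem_insert _ _)
  have hwH : w ∈ ccHull G (insert u (S \ {w})) := by
    classical
    refine ccConvex_iff_forall_isCycle.1 ccConvex_ccHull w (p.rotate w hwp) (hp.rotate hwp)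
      fun x hx ↦ ?_
    obtain rfl | rfl | h := hpS x ((Walk.mem_support_rotate_iff ..).1 hx)
    exacts [.inr huH, .inl rfl, .inr (hle h)]
  have hSH : S ⊆ ccHull G (insert u (S \ {w})) :=
    hsub.trans (Set.insert_subset hwH hle)
  exact Set.univ_subset_iff.1 (hS ▸ ccHull_subset hSH ccConvex_ccHull)

end CycleConvexity

/-- Every minimum hull set of `G` contains `w` iff `{w}` is a co-convex set of `G`. -/
theorem mem_every_minimum_hullSet_iff_singleton_coconvex {V : Type*} [Fintype V]
    (G : SimpleGraph V) (w : V) :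
    (∀ S : Set V, IsHullSet G S → S.ncard = hnCC G → w ∈ S) ↔
      CcConvex G (Set.univ \ {w}) := by
  refine ⟨fun h ↦ ?_, fun h S hS _ ↦ hS.mem_of_ccConvex_compl_singleton h⟩
  by_contra hw
  obtain ⟨S, hcard, hS⟩ := exists_isHullSet_ncard_eq_hnCC (G := G)
  have hwS : w ∈ S := h S hS hcard
  have hwT : w ∉ ccHull G (S \ {w}) := by
    intro hwT
    have hsub : S ⊆ ccHull G (S \ {w}) := fun x hx ↦ by
      by_cases hxw : x = w
      exacts [hxw ▸ hwT, subset_ccHull ⟨hx, hxw⟩]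
    have hS' : IsHullSet G (S \ {w}) :=
      Set.univ_subset_iff.1 (hS ▸ ccHull_subset hsub ccConvex_ccHull)
    have := hS'.hnCC_le_ncard
    have := Set.ncard_sdiff_singleton_lt_of_mem hwS (Set.toFinite S)
    omega
  obtain ⟨u, huw, huT, hu⟩ := hS.exists_exchange hw hwT
  have huS : u ∉ S := fun hus ↦ huT (subset_ccHull ⟨hus, huw⟩)
  obtain hwu | hwS' := h _ hu ((Set.ncard_exchange huS hwS).trans hcard)
  exacts [huw hwu.symm, hwS'.2 rfl]
end

section
/- Let G = (V, E) be a finite simple graph and v ∈ V a vertex that lies in no cycle of G. Then hn_cc(G) = hn_cc(G − v) + 1, where G − v is the subgraph of G induced by V \ {v}. -/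
open SimpleGraph

theorem isCycle_induce {V : Type*} {G : SimpleGraph V} {s : Set V} {x : V} {w : G.Walk x x}
    (hw : w.IsCycle) (hs : ∀ u ∈ w.support, u ∈ s) : (w.induce s hs).IsCycle := by
  refine (Walk.isCycle_map_iff_of_injective (f := (Embedding.induce (G := G) s).toHom)
    (Embedding.induce (G := G) s).injective).1 ?_
  exact (Walk.map_induce w hs).symm ▸ hw

theorem exists_isCycle_of_induce {V : Type*} {G : SimpleGraph V} {s : Set V} {x : s}
    {w : (G.induce s).Walk x x} (hw : w.IsCycle) :
    ∃ w' : G.Walk x x, w'.IsCycle ∧ w'.support = w.support.map Subtype.val :=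
  ⟨w.map (Embedding.induce s).toHom,
    (Walk.isCycle_map_iff_of_injective (f := (Embedding.induce (G := G) s).toHom)
      (Embedding.induce (G := G) s).injective).2 hw,
    Walk.support_map _ _⟩

theorem mem_Icc_iff {V : Type*} (G : SimpleGraph V) (S : Set V) (x : V) :
    x ∈ Icc G S ↔ x ∈ S ∨ ∃ w : G.Walk x x, w.IsCycle ∧ ∀ u ∈ w.support, u ∈ insert x S := by
  refine or_congr_right ⟨?_, ?_⟩
  · rintro ⟨w, hw⟩
    obtain ⟨w', hw', hsupp⟩ := exists_isCycle_of_induce hw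
    refine ⟨w', hw', fun u hu => ?_⟩
    rw [hsupp] at hu
    obtain ⟨y, -, rfl⟩ := List.mem_map.1 hu
    exact y.2
  · rintro ⟨w, hw, hs⟩
    exact ⟨w.induce _ hs, isCycle_induce hw hs⟩

theorem isHullSet_iff {V : Type*} (G : SimpleGraph V) (S : Set V) :
    IsHullSet G S ↔ ∀ T, S ⊆ T → CcConvex G T → T = Set.univ := by
  simp [IsHullSet, ccHull, Set.sInter_eq_univ]

theorem mem_Icc_induce_iff {V : Type*} (G : SimpleGraph V) (v : V)
    (hv : ∀ (u : V) (w : G.Walk u u), w.IsCycle → v ∉ w.support) (T : Set V)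
    (x : ({v}ᶜ : Set V)) :
    x ∈ Icc (G.induce ({v}ᶜ : Set V)) (Subtype.val ⁻¹' T) ↔ (x : V) ∈ Icc G T := by
  rw [mem_Icc_iff, mem_Icc_iff]
  refine or_congr Iff.rfl ⟨?_, ?_⟩
  · rintro ⟨w, hw, hs⟩
    obtain ⟨w', hw', hsupp⟩ := exists_isCycle_of_induce hw
    refine ⟨w', hw', fun u hu => ?_⟩
    rw [hsupp] at hu
    obtain ⟨y, hy, rfl⟩ := List.mem_map.1 hu
    exact (hs y hy).imp (congrArg Subtype.val) id
  · rintro ⟨w, hw, hs⟩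
    have hc : ∀ u ∈ w.support, u ∈ ({v}ᶜ : Set V) := by
      rintro u hu rfl
      exact hv _ w hw hu
    refine ⟨w.induce _ hc, isCycle_induce hw hc, fun u hu => ?_⟩
    rw [Walk.support_induce] at hu
    have hu' : (u : V) ∈ w.support := by simpa using hu
    exact (hs u hu').imp Subtype.ext id

theorem ccConvex_induce_iff {V : Type*} (G : SimpleGraph V) (v : V)
    (hv : ∀ (u : V) (w : G.Walk u u), w.IsCycle → v ∉ w.support) (T : Set V) (hT : v ∈ T) :
    CcConvex (G.induce ({v}ᶜ : Set V)) (Subtype.val ⁻¹' T) ↔ CcConvex G T := by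
  simp only [CcConvex, Set.ext_iff, mem_Icc_induce_iff G v hv, Set.mem_preimage]
  refine ⟨fun h x => ?_, fun h x => h x⟩
  by_cases hx : x = v
  · subst hx
    exact iff_of_true (Or.inl hT) hT
  · exact h ⟨x, hx⟩

theorem IsHullSet.mem_of_notMem_cycle {V : Type*} {G : SimpleGraph V} {v : V}
    (hv : ∀ (u : V) (w : G.Walk u u), w.IsCycle → v ∉ w.support) {S : Set V}
    (hS : IsHullSet G S) : v ∈ S := by
  by_contra h
  have hconv : CcConvex G {v}ᶜ := by
    ext x
    rw [mem_Icc_iff]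
    refine ⟨?_, Or.inl⟩
    rintro (hx | ⟨w, hw, -⟩)
    · exact hx
    · rintro rfl
      exact hv _ w hw w.start_mem_support
  have := (isHullSet_iff G S).1 hS _ (Set.subset_compl_singleton_iff.2 h) hconv
  exact (this ▸ Set.mem_univ v : v ∈ ({v}ᶜ : Set V)) rfl

theorem isHullSet_induce_iff {V : Type*} (G : SimpleGraph V) (v : V)
    (hv : ∀ (u : V) (w : G.Walk u u), w.IsCycle → v ∉ w.support)
    (S : Set ({v}ᶜ : Set V)) :
    IsHullSet (G.induce ({v}ᶜ : Set V)) S ↔ IsHullSet G (insert v (Subtype.val '' S)) := by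
  rw [isHullSet_iff, isHullSet_iff]
  constructor
  · intro h T hST hT
    obtain ⟨hvT, hST⟩ := Set.insert_subset_iff.1 hST
    have := h _ (Set.image_subset_iff.1 hST) ((ccConvex_induce_iff G v hv T hvT).2 hT)
    refine Set.eq_univ_of_forall fun x => ?_
    by_cases hx : x = v
    · exact hx ▸ hvT
    · exact Set.eq_univ_iff_forall.1 this ⟨x, hx⟩
  · intro h T hST hT
    have hpre : Subtype.val ⁻¹' (insert v (Subtype.val '' T)) = T := by
      ext ⟨x, hx⟩
      simp [show x ≠ v from hx]
    have := h _ (Set.insert_subset_insert (Set.image_mono hST))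
      ((ccConvex_induce_iff G v hv _ (Set.mem_insert _ _)).1 (hpre.symm ▸ hT))
    rw [← hpre, this, Set.preimage_univ]

theorem exists_ncard_eq_hnCC {V : Type*} (G : SimpleGraph V) :
    ∃ S : Set V, S.ncard = hnCC G ∧ IsHullSet G S :=
  Nat.sInf_mem (s := {n | ∃ S : Set V, S.ncard = n ∧ IsHullSet G S})
    ⟨_, Set.univ, rfl, (isHullSet_iff G _).2 fun _ h _ => Set.univ_subset_iff.1 h⟩

theorem IsHullSet.hnCC_le {V : Type*} {G : SimpleGraph V} {S : Set V} (hS : IsHullSet G S) :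
    hnCC G ≤ S.ncard :=
  Nat.sInf_le ⟨S, rfl, hS⟩

theorem ncard_insert_image_val {V : Type*} [Finite V] (v : V) (S : Set ({v}ᶜ : Set V)) :
    (insert v (Subtype.val '' S)).ncard = S.ncard + 1 := by
  rw [Set.ncard_insert_of_notMem (by rintro ⟨x, -, hx⟩; exact x.2 hx) (Set.toFinite _),
    Set.ncard_image_of_injective _ Subtype.val_injective]

/-- If `v` lies in no cycle of `G`, then `hn_cc(G) = hn_cc(G - v) + 1`. -/
theorem hnCC_delete_vertex_not_in_cycle {V : Type*} [Fintype V] (G : SimpleGraph V)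
    (v : V) (hv : ∀ (u : V) (w : G.Walk u u), w.IsCycle → v ∉ w.support) :
    hnCC G = hnCC (G.induce ({v}ᶜ : Set V)) + 1 := by
  apply le_antisymm
  · obtain ⟨S, hcard, hS⟩ := exists_ncard_eq_hnCC (G.induce ({v}ᶜ : Set V))
    rw [← hcard, ← ncard_insert_image_val]
    exact ((isHullSet_induce_iff G v hv S).1 hS).hnCC_le
  · obtain ⟨S, hcard, hS⟩ := exists_ncard_eq_hnCC G
    have hins : insert v (Subtype.val '' (Subtype.val ⁻¹' S : Set ({v}ᶜ : Set V))) = S := by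
      have hvS := hS.mem_of_notMem_cycle hv
      ext x
      by_cases hx : x = v <;> simp [hx, hvS]
    rw [← hcard, ← hins, ncard_insert_image_val]
    rw [← hins] at hS
    exact Nat.succ_le_succ ((isHullSet_induce_iff G v hv _).2 hS).hnCC_le
end

section
/- Let G be a finite connected simple graph on n ≥ 2 vertices with exactly p blocks. Then hn_cc(G) ≥ p + 1. -/
open SimpleGraph

/-- A vertex set `B` induces a connected subgraph of `G` with no cut-vertex of its own:
removing any vertex of `B` from `G[B]` leaves at most one connected component. -/
def NoCutConn {V : Type*} (G : SimpleGraph V) (B : Set V) : Prop :=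
  (G.induce B).Connected ∧
  ∀ v ∈ B, Nat.card ((G.induce (B \ {v})).ConnectedComponent) ≤ 1

/-- A block of `G`: a maximal connected subgraph of `G` having no cut-vertex of its own. -/
def IsBlock {V : Type*} (G : SimpleGraph V) (B : Set V) : Prop :=
  NoCutConn G B ∧ ∀ B' : Set V, B ⊆ B' → NoCutConn G B' → B' = B

/-- There is a walk from `u` to `w` which does not visit `x`. -/
def ReachableAvoiding {V : Type*} (G : SimpleGraph V) (x u w : V) : Prop :=
  ∃ p : G.Walk u w, x ∉ p.support

namespace ReachableAvoiding

variable {V : Type*} {G : SimpleGraph V} {x u w z : V}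

lemma refl (h : u ≠ x) : ReachableAvoiding G x u u :=
  ⟨.nil, by simpa using h.symm⟩

lemma symm : ReachableAvoiding G x u w → ReachableAvoiding G x w u :=
  fun ⟨p, hp⟩ => ⟨p.reverse, by simpa using hp⟩

lemma trans : ReachableAvoiding G x u w → ReachableAvoiding G x w z →
    ReachableAvoiding G x u z :=
  fun ⟨p, hp⟩ ⟨q, hq⟩ => ⟨p.append q, by simp [Walk.mem_support_append_iff, hp, hq]⟩

lemma of_adj (h : G.Adj u w) (hu : u ≠ x) (hw : w ≠ x) : ReachableAvoiding G x u w :=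
  ⟨h.toWalk, by simp [hu.symm, hw.symm]⟩

lemma of_reachable_induce {A : Set V} (hx : x ∉ A) {a b : A}
    (h : (G.induce A).Reachable a b) : ReachableAvoiding G x a b := by
  obtain ⟨p⟩ := h
  induction p with
  | nil => exact refl (ne_of_mem_of_not_mem (Subtype.prop _) hx)
  | cons h _ ih =>
    exact (of_adj (by simpa using h) (ne_of_mem_of_not_mem (Subtype.prop _) hx)
      (ne_of_mem_of_not_mem (Subtype.prop _) hx)).trans ih

end ReachableAvoiding

/-- No vertex of `G` separates two vertices of `B`. -/
def InseparableIn {V : Type*} (G : SimpleGraph V) (B : Set V) : Prop :=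
  ∀ x, ∀ u ∈ B, ∀ w ∈ B, u ≠ x → w ≠ x → ReachableAvoiding G x u w

section

variable {V : Type*} {G : SimpleGraph V}

lemma NoCutConn.inseparable {B : Set V} [Finite V] (h : NoCutConn G B) : InseparableIn G B := by
  intro x u hu w hw hux hwx
  by_cases hx : x ∈ B
  · have := Finite.card_le_one_iff_subsingleton.1 (h.2 x hx)
    have hr := ConnectedComponent.exact (Subsingleton.elim
      ((G.induce (B \ {x})).connectedComponentMk ⟨u, hu, hux⟩)
      ((G.induce (B \ {x})).connectedComponentMk ⟨w, hw, hwx⟩))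
    exact .of_reachable_induce (by simp) hr
  · exact .of_reachable_induce hx (h.1.preconnected ⟨u, hu⟩ ⟨w, hw⟩)

/-- Adding a path between two members of an inseparable set keeps it inseparable. -/
lemma InseparableIn.union_support {B : Set V} (hB : InseparableIn G B) {u w : V} (hu : u ∈ B)
    (hw : w ∈ B) (p : G.Walk u w) (hp : p.IsPath) :
    InseparableIn G (B ∪ {y | y ∈ p.support}) := by
  classical
  intro x
  have key : ∀ y ∈ B ∪ {y | y ∈ p.support}, y ≠ x →
      ∃ b ∈ B, b ≠ x ∧ ReachableAvoiding G x y b := by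
    rintro y (hy | hy) hyx
    · exact ⟨y, hy, hyx, .refl hyx⟩
    · have hy : y ∈ p.support := hy
      by_cases h1 : x ∈ (p.takeUntil y hy).support
      · have h2 : x ∉ (p.dropUntil y hy).support := by
          intro h2
          have hnd := hp.support_nodup
          rw [← p.take_spec hy, Walk.support_append, List.nodup_append'] at hnd
          refine hnd.2.2 h1 ?_
          rw [Walk.mem_support_iff] at h2
          exact h2.resolve_left (Ne.symm hyx)
        exact ⟨w, hw, fun e => h2 (e ▸ Walk.end_mem_support _), _, h2⟩
      · exact ⟨u, hu, fun e => h1 (e ▸ Walk.start_mem_support _), .symm ⟨_, h1⟩⟩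
  intro a ha b hb hax hbx
  obtain ⟨a', ha', hax', h1⟩ := key a ha hax
  obtain ⟨b', hb', hbx', h2⟩ := key b hb hbx
  exact (h1.trans (hB x a' ha' b' hb' hax' hbx')).trans h2.symm

lemma InseparableIn.pair {u w : V} (h : G.Adj u w) : InseparableIn G {u, w} := by
  rintro x a (rfl | rfl) b (rfl | rfl) hax hbx
  · exact .refl hax
  · exact .of_adj h hax hbx
  · exact .of_adj h.symm hax hbx
  · exact .refl hax

lemma InseparableIn.singleton (u : V) : InseparableIn G {u} := by
  rintro x a rfl b rfl hax -
  exact .refl hax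

/-- Two inseparable sets sharing `v`, and joined by a walk avoiding `v`, have an inseparable
union. -/
lemma InseparableIn.union {B C : Set V} (hB : InseparableIn G B) (hC : InseparableIn G C)
    {v b c : V} (hvB : v ∈ B) (hvC : v ∈ C) (hb : b ∈ B) (hc : c ∈ C)
    (hbv : b ≠ v) (hcv : c ≠ v) (h : ReachableAvoiding G v b c) : InseparableIn G (B ∪ C) := by
  intro x
  by_cases hx : x = v
  · subst hx
    have key : ∀ y ∈ B ∪ C, y ≠ x → ReachableAvoiding G x y b := by
      rintro y (hy | hy) hyx
      · exact hB x y hy b hb hyx hbv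
      · exact (hC x y hy c hc hyx hcv).trans h.symm
    exact fun u hu w hw hux hwx => (key u hu hux).trans (key w hw hwx).symm
  · have key : ∀ y ∈ B ∪ C, y ≠ x → ReachableAvoiding G x y v := by
      rintro y (hy | hy) hyx
      · exact hB x y hy v hvB hyx (Ne.symm hx)
      · exact hC x y hy v hvC hyx (Ne.symm hx)
    exact fun u hu w hw hux hwx => (key u hu hux).trans (key w hw hwx).symm

lemma support_subset_of_maximal_inseparable {B : Set V} (hB : Maximal (InseparableIn G) B)
    {u w : V} (hu : u ∈ B) (hw : w ∈ B) (p : G.Walk u w) (hp : p.IsPath) :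
    ∀ y ∈ p.support, y ∈ B :=
  fun _ hy => hB.le_of_ge (hB.prop.union_support hu hw p hp) Set.subset_union_left (Or.inr hy)

lemma noCutConn_of_maximal_inseparable (hconn : G.Connected) {B : Set V}
    (hB : Maximal (InseparableIn G) B) : NoCutConn G B := by
  classical
  refine ⟨?_, fun v _ => ?_⟩
  · have hne : B.Nonempty := by
      by_contra h
      rw [Set.not_nonempty_iff_eq_empty] at h
      obtain ⟨u⟩ := hconn.nonempty
      have := hB.le_of_ge (InseparableIn.singleton u) (by simp [h]) rfl
      simp [h] at this
    have := hne.to_subtype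
    refine ⟨fun ⟨u, hu⟩ ⟨w, hw⟩ => ?_⟩
    obtain ⟨p, hp⟩ := hconn.exists_isPath u w
    exact (p.induce B (support_subset_of_maximal_inseparable hB hu hw p hp)).reachable
  · have : Subsingleton (G.induce (B \ {v})).ConnectedComponent := by
      refine ⟨ConnectedComponent.ind₂ ?_⟩
      rintro ⟨u, hu, huv⟩ ⟨w, hw, hwv⟩
      obtain ⟨p, hp⟩ := hB.prop v u hu w hw huv hwv
      have hsub : ∀ y ∈ p.bypass.support, y ∈ B \ {v} := fun y hy =>
        ⟨support_subset_of_maximal_inseparable hB hu hw _ p.bypass_isPath y hy,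
          fun h => hp (h ▸ p.support_bypass_subset_support hy)⟩
      exact ConnectedComponent.sound (p.bypass.induce _ hsub).reachable
    exact Finite.card_le_one_iff_subsingleton.2 this

lemma isBlock_iff_maximal_inseparable [Finite V] (hconn : G.Connected) {B : Set V} :
    IsBlock G B ↔ Maximal (InseparableIn G) B := by
  constructor
  · rintro ⟨h1, h2⟩
    obtain ⟨M, hBM, hM⟩ := (Set.toFinite {B | InseparableIn G B}).exists_le_maximal h1.inseparable
    have := h2 M hBM (noCutConn_of_maximal_inseparable hconn hM)
    exact this ▸ hM
  · exact fun h => ⟨noCutConn_of_maximal_inseparable hconn h,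
      fun B' hBB' hB' => (h.eq_of_le hB'.inseparable hBB').symm⟩

lemma IsBlock.two_le_ncard [Finite V] [Nontrivial V] (hconn : G.Connected) {B : Set V}
    (h : IsBlock G B) : 2 ≤ B.ncard := by
  obtain ⟨v, hv⟩ := Set.nonempty_coe_sort.1 h.1.1.nonempty
  rw [isBlock_iff_maximal_inseparable hconn] at h
  obtain ⟨w, hw⟩ := hconn.preconnected.exists_adj_of_nontrivial v
  by_contra! hlt
  have hBv : B = {v} := Set.eq_singleton_iff_unique_mem.2
    ⟨hv, fun y hy => (Set.ncard_le_one (Set.toFinite B)).1 (by omega) y hy v hv⟩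
  have := h.le_of_ge (InseparableIn.pair hw) (by simp [hBv]) (Or.inr rfl)
  exact hw.ne (by simpa [hBv, eq_comm] using this)

lemma SimpleGraph.Walk.IsCycle.exists_adj_reachableAvoiding {v : V} {c : G.Walk v v}
    (hc : c.IsCycle) :
    ∃ a b, G.Adj v a ∧ G.Adj v b ∧ a ≠ b ∧ ReachableAvoiding G v a b := by
  cases c with
  | nil => exact absurd rfl hc.ne_nil
  | @cons _ a _ h q =>
    obtain ⟨hq, he⟩ := (Walk.cons_isCycle_iff q h).1 hc
    obtain ⟨r, rfl⟩ : ∃ r : G.Walk v a, q = r.reverse := ⟨q.reverse, by simp⟩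
    cases r with
    | nil => exact absurd rfl h.ne
    | @cons _ b _ h' r =>
      rw [Walk.isPath_reverse_iff, Walk.cons_isPath_iff] at hq
      refine ⟨a, b, h, h', ?_, ReachableAvoiding.symm ⟨r, hq.2⟩⟩
      rintro rfl
      simp at he

/-- A vertex outside `T` on a cycle of `G[T ∪ {v}]` shares a block with two vertices of `T`. -/
lemma exists_isBlock_of_mem_Icc [Finite V] (hconn : G.Connected) {T : Set V} {v : V}
    (hv : v ∈ Icc G T) (hvT : v ∉ T) :
    ∃ B, IsBlock G B ∧ v ∈ B ∧ ∃ a ∈ B ∩ T, ∃ b ∈ B ∩ T, a ≠ b := by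
  obtain hv | ⟨c, hc⟩ := hv
  · exact absurd hv hvT
  obtain ⟨a, b, ha, hb, hab, p, hp⟩ := hc.exists_adj_reachableAvoiding
  have hmem : ∀ y : ↥(insert v T), y ≠ ⟨v, Set.mem_insert v T⟩ → (y : V) ∈ T := fun y hy =>
    y.2.resolve_left fun e => hy (Subtype.ext e)
  have hav : G.Adj v a := by simpa using ha
  have hbv : G.Adj v b := by simpa using hb
  have hconnect : ReachableAvoiding G v a b := by
    suffices h : v ∉ (p.map (Embedding.induce _).toHom).support from ⟨_, h⟩
    rw [Walk.support_map, List.mem_map]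
    rintro ⟨y, hy, hyv⟩
    exact hp ((show y = ⟨v, Set.mem_insert v T⟩ from Subtype.ext hyv) ▸ hy)
  have hins : InseparableIn G ({v, (a : V)} ∪ {v, (b : V)}) :=
    (InseparableIn.pair hav).union (InseparableIn.pair hbv) (v := v) (by simp) (by simp)
      (by simp) (by simp) hav.ne' hbv.ne' hconnect
  obtain ⟨M, hBM, hM⟩ := (Set.toFinite {B | InseparableIn G B}).exists_le_maximal hins
  exact ⟨M, (isBlock_iff_maximal_inseparable hconn).2 hM, hBM (by simp),
    a, ⟨hBM (by simp), hmem _ ha.ne'⟩, b, ⟨hBM (by simp), hmem _ hb.ne'⟩,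
    fun e => hab (Subtype.ext e)⟩

/-- The vertices of `B` that do not separate the rest of `B` from the root `r`. -/
def nonRootVertices (G : SimpleGraph V) (r : V) (B : Set V) : Set V :=
  {v | v ∈ B ∧ ∃ w ∈ B, w ≠ v ∧ ReachableAvoiding G v r w}

lemma ncard_le_nonRootVertices_add_one [Finite V] (hconn : G.Connected) (r : V) (B : Set V) :
    B.ncard ≤ (nonRootVertices G r B).ncard + 1 := by
  have hsub : (B \ nonRootVertices G r B).ncard ≤ 1 := by
    rw [Set.ncard_le_one (Set.toFinite _)]
    have key : ∀ v ∈ B, ∀ w ∈ B, v ≠ w → G.dist r v ≤ G.dist r w →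
        w ∈ nonRootVertices G r B := by
      classical
      intro v hv w hw hvw hle
      obtain ⟨p, hp⟩ := hconn.exists_walk_length_eq_dist r v
      refine ⟨hw, v, hv, hvw, p, fun hwp => ?_⟩
      have h1 := dist_le (p.takeUntil w hwp)
      have h2 := p.length_takeUntil_lt_length hwp hvw.symm
      omega
    rintro v ⟨hv, hv'⟩ w ⟨hw, hw'⟩
    by_contra hvw
    rcases le_total (G.dist r v) (G.dist r w) with h | h
    · exact hw' (key v hv w hw hvw h)
    · exact hv' (key w hw v hv (Ne.symm hvw) h)
  have := Set.ncard_le_ncard_sdiff_add_ncard B (nonRootVertices G r B) (Set.toFinite _)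
  omega

lemma IsBlock.disjoint_nonRootVertices [Finite V] (hconn : G.Connected) (r : V) {B C : Set V}
    (hB : IsBlock G B) (hC : IsBlock G C) (hBC : B ≠ C) :
    Disjoint (nonRootVertices G r B) (nonRootVertices G r C) := by
  rw [isBlock_iff_maximal_inseparable hconn] at hB hC
  rw [Set.disjoint_left]
  rintro v ⟨hvB, b, hb, hbv, hrb⟩ ⟨hvC, c, hc, hcv, hrc⟩
  have h := hB.prop.union hC.prop hvB hvC hb hc hbv hcv (hrb.symm.trans hrc)
  exact hBC ((hB.eq_of_le h Set.subset_union_left).trans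
    (hC.eq_of_le h Set.subset_union_right).symm)

lemma sum_ncard_sub_one_lt_card [Fintype V] (hconn : G.Connected) (F : Finset (Set V))
    (hF : ∀ B ∈ F, IsBlock G B) : ∑ B ∈ F, (B.ncard - 1) < Fintype.card V := by
  classical
  obtain ⟨r⟩ := hconn.nonempty
  calc ∑ B ∈ F, (B.ncard - 1)
      ≤ ∑ B ∈ F, (nonRootVertices G r B).toFinset.card := by
        refine Finset.sum_le_sum fun B _ => ?_
        have := ncard_le_nonRootVertices_add_one hconn r B
        rw [← Set.ncard_eq_toFinset_card']
        omega
    _ = (F.biUnion fun B => (nonRootVertices G r B).toFinset).card := by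
        refine (Finset.card_biUnion fun B hB C hC hBC => ?_).symm
        exact Set.disjoint_toFinset.2 <| (hF B hB).disjoint_nonRootVertices hconn r (hF C hC) hBC
    _ < Fintype.card V := by
        refine Finset.card_lt_univ_of_notMem (x := r) ?_
        simp only [Finset.mem_biUnion, Set.mem_toFinset, not_exists, not_and]
        rintro B - ⟨-, w, -, -, p, hp⟩
        exact hp p.start_mem_support

/-- A hull set can be completed to the whole vertex set by adding blocks one at a time, each
meeting the previous vertices at least twice. -/
lemma IsHullSet.exists_card_le [Fintype V] (hconn : G.Connected) {S : Set V}
    (hS : IsHullSet G S) : ∃ F : Finset (Set V), (∀ B ∈ F, IsBlock G B) ∧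
      Fintype.card V ≤ S.ncard + ∑ B ∈ F, (B.ncard - 2) := by
  classical
  let P : Set V → Prop := fun T => S ⊆ T ∧ ∃ F : Finset (Set V), (∀ B ∈ F, IsBlock G B) ∧
    (∀ B ∈ F, B ⊆ T) ∧ T.ncard ≤ S.ncard + ∑ B ∈ F, (B.ncard - 2)
  obtain ⟨T, -, hT⟩ := (Set.toFinite {T | P T}).exists_le_maximal
    (show P S from ⟨subset_rfl, ∅, by simp⟩)
  obtain ⟨hST, F, hF, hFT, hcard⟩ := hT.prop
  have hconv : CcConvex G T := by
    refine Set.Subset.antisymm (fun v hv => ?_) Set.subset_union_left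
    by_contra hvT
    obtain ⟨B, hB, hvB, a, ha, b, hb, hab⟩ := exists_isBlock_of_mem_Icc hconn hv hvT
    have hBF : B ∉ F := fun h => hvT (hFT B h hvB)
    refine hvT (hT.le_of_ge (y := T ∪ B) ⟨hST.trans Set.subset_union_left, insert B F, ?_, ?_, ?_⟩
      Set.subset_union_left (Or.inr hvB))
    · simpa [hB] using hF
    · simpa using fun C hC => (hFT C hC).trans Set.subset_union_left
    · rw [Finset.sum_insert hBF]
      have h1 := Set.ncard_union_add_ncard_inter T B
      have h2 : 1 < (T ∩ B).ncard :=
        (Set.one_lt_ncard (Set.toFinite _)).2 ⟨a, ha.symm, b, hb.symm, hab⟩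
      omega
  have huniv : T = Set.univ := Set.univ_subset_iff.1 (hS ▸ Set.sInter_subset_of_mem ⟨hST, hconv⟩)
  refine ⟨F, hF, ?_⟩
  rwa [huniv, Set.ncard_univ, Nat.card_eq_fintype_card] at hcard

end

/-- A connected simple graph on at least 2 vertices with exactly `p` blocks satisfies
`hn_cc(G) ≥ p + 1`. -/
theorem hnCC_ge_blocks_add_one {V : Type*} [Fintype V] (G : SimpleGraph V)
    (hconn : G.Connected) (hn : 2 ≤ Fintype.card V) (p : ℕ)
    (hp : {B : Set V | IsBlock G B}.ncard = p) :
    p + 1 ≤ hnCC G := by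
  classical
  have : Nontrivial V := Fintype.one_lt_card_iff_nontrivial.1 hn
  have hmem : hnCC G ∈ {n | ∃ S : Set V, S.ncard = n ∧ IsHullSet G S} :=
    Nat.sInf_mem ⟨_, Set.univ, rfl,
      Set.univ_subset_iff.1 (Set.subset_sInter fun _ hT => hT.1)⟩
  obtain ⟨S, hcard, hS⟩ := hmem
  obtain ⟨F, hF, hle⟩ := hS.exists_card_le hconn
  let A : Finset (Set V) := {B : Set V | IsBlock G B}.toFinset
  have hA : ∀ B ∈ A, IsBlock G B := fun B hB => by simpa [A] using hB
  have hAp : A.card = p := by rw [← hp, Set.ncard_eq_toFinset_card']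
  have hlt := sum_ncard_sub_one_lt_card hconn A hA
  have hsum : ∑ B ∈ A, (B.ncard - 1) = ∑ B ∈ A, (B.ncard - 2) + p := by
    rw [← hAp, Finset.card_eq_sum_ones, ← Finset.sum_add_distrib]
    refine Finset.sum_congr rfl fun B hB => ?_
    have := (hA B hB).two_le_ncard hconn
    omega
  have hFA : ∑ B ∈ F, (B.ncard - 2) ≤ ∑ B ∈ A, (B.ncard - 2) :=
    Finset.sum_le_sum_of_subset fun B hB => by simpa [A] using hF B hB
  omega
end

section
/- Let G be a finite simple 2-connected chordal graph. Then for every edge uv ∈ E(G), the set {u, v} is a hull set of G in the cycle convexity, i.e. hull({u, v}) = V(G). -/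
open SimpleGraph

/-- A graph is chordal if it has no induced cycle of length greater than 3;
equivalently, every cycle of length at least 4 has a chord. -/
def Chordal {V : Type*} (G : SimpleGraph V) : Prop :=
  ∀ ⦃v : V⦄ (w : G.Walk v v), w.IsCycle → 4 ≤ w.length →
    ∃ x y, x ∈ w.support ∧ y ∈ w.support ∧ G.Adj x y ∧ ¬ w.toSubgraph.Adj x y

namespace SimpleGraph

variable {V : Type*} {G : SimpleGraph V}

/-- `p` stays in `S` and has minimum length among the walks in `S` with the same ends. -/
def Walk.IsShortestIn {a b : V} (p : G.Walk a b) (S : Set V) : Prop :=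
  (∀ x ∈ p.support, x ∈ S) ∧ ∀ q : G.Walk a b, (∀ x ∈ q.support, x ∈ S) → p.length ≤ q.length

namespace Walk

theorem exists_isShortestIn {a b : V} {S : Set V} (p : G.Walk a b) (hp : ∀ x ∈ p.support, x ∈ S) :
    ∃ q : G.Walk a b, q.IsShortestIn S := by
  classical
  have h : ∃ n, ∃ q : G.Walk a b, (∀ x ∈ q.support, x ∈ S) ∧ q.length = n := ⟨_, p, hp, rfl⟩
  obtain ⟨q, hq, hn⟩ := Nat.find_spec h
  exact ⟨q, hq, fun r hr => hn.trans_le (Nat.find_min' h ⟨r, hr, rfl⟩)⟩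

theorem IsShortestIn.isPath {a b : V} {S : Set V} {p : G.Walk a b} (hp : p.IsShortestIn S) :
    p.IsPath := by
  classical
  have h := hp.2 p.bypass fun x hx => hp.1 x (p.support_bypass_subset_support hx)
  rw [← p.bypass_eq_self_of_length_le_length_bypass h]
  exact p.bypass_isPath

/-- A shortest walk in `S` has no chord. -/
theorem IsShortestIn.mem_edges {a b : V} {S : Set V} {p : G.Walk a b} (hp : p.IsShortestIn S)
    {x y : V} (hx : x ∈ p.support) (hy : y ∈ p.support) (hxy : G.Adj x y) :
    s(x, y) ∈ p.edges := by
  obtain ⟨i, rfl, hi⟩ := mem_support_iff_exists_getVert.1 hx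
  obtain ⟨j, rfl, hj⟩ := mem_support_iff_exists_getVert.1 hy
  have key : ∀ i j, i < j → j ≤ p.length → G.Adj (p.getVert i) (p.getVert j) →
      s(p.getVert i, p.getVert j) ∈ p.edges := by
    intro i j hij hj h
    have := hp.2 ((p.take i).append (cons h (p.drop j))) (by
      intro z hz
      rw [mem_support_append_iff, support_cons, List.mem_cons] at hz
      rcases hz with hz | rfl | hz
      · exact hp.1 z (p.isSubwalk_take i |>.support_subset hz)
      · exact hp.1 _ (p.getVert_mem_support i)
      · exact hp.1 z (p.isSubwalk_drop j |>.support_subset hz))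
    simp only [length_append, length_cons, take_length, drop_length] at this
    obtain rfl : j = i + 1 := by omega
    rw [← adj_toSubgraph_iff_mem_edges]
    exact p.toSubgraph_adj_getVert (by omega)
  rcases lt_trichotomy i j with h | rfl | h
  · exact key i j h hj hxy
  · exact absurd hxy (G.irrefl)
  · rw [Sym2.eq_swap]
    exact key j i h hi hxy.symm

/-- The first entrance of a walk into a set. -/
theorem exists_walk_compl_adj {A : Set V} {x z : V} (w : G.Walk x z) (hx : x ∉ A) (hz : z ∈ A) :
    ∃ y c, ∃ q : G.Walk x y, (∀ t ∈ q.support, t ∈ Aᶜ) ∧ G.Adj y c ∧ c ∈ A ∧ c ∈ w.support := by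
  induction w with
  | nil => exact absurd hz hx
  | @cons x y z h p ih =>
    by_cases hy : y ∈ A
    · exact ⟨x, y, nil, by simpa using hx, h, hy, by simp⟩
    · obtain ⟨y', c, q, hq, h', hc, hcp⟩ := ih hy hz
      exact ⟨y', c, cons h q, by simpa using ⟨hx, by simpa using hq⟩, h', hc, by simp [hcp]⟩

/-- Two disjoint paths whose ends are joined crosswise by edges form a cycle. -/
theorem isCycle_cons_append_cons {a b x y : V} {q : G.Walk x y} {p : G.Walk b a} (hq : q.IsPath)
    (hp : p.IsPath) (hqp : ∀ z ∈ q.support, z ∉ p.support) (hax : G.Adj a x) (hyb : G.Adj y b)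
    (hne : a ≠ b ∨ x ≠ y) : (cons hax (q.append (cons hyb p))).IsCycle := by
  rw [cons_isCycle_iff]
  constructor
  · rw [isPath_def, support_append, support_cons, List.tail_cons, List.nodup_append']
    exact ⟨hq.support_nodup, hp.support_nodup, fun z h h' => hqp z h h'⟩
  · rw [edges_append, edges_cons, List.mem_append, List.mem_cons]
    rintro (h | h | h)
    · exact hqp a (q.fst_mem_support_of_mem_edges h) p.end_mem_support
    · rcases Sym2.eq_iff.1 h with ⟨rfl, -⟩ | ⟨h, h'⟩
      · exact hqp _ q.end_mem_support p.end_mem_support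
      · exact hne.elim (· h) (· h')
    · exact hqp x q.start_mem_support (p.snd_mem_support_of_mem_edges h)

end Walk

/-- In a chordal graph, two disjoint nontrivial chordless paths whose ends are joined crosswise by
edges have a further edge between them. -/
theorem _root_.Chordal.exists_adj_between (hG : Chordal G) {S T : Set V} {a b x y : V} {q : G.Walk x y}
    {p : G.Walk b a} (hq : q.IsShortestIn S) (hp : p.IsShortestIn T)
    (hqp : ∀ z ∈ q.support, z ∉ p.support) (hax : G.Adj a x) (hyb : G.Adj y b) (hab : a ≠ b)
    (hxy : x ≠ y) :
    ∃ z ∈ q.support, ∃ c ∈ p.support, G.Adj z c ∧ ¬ (z = x ∧ c = a) ∧ ¬ (z = y ∧ c = b) := by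
  have hql : q.length ≠ 0 := fun h => hxy (Walk.eq_of_length_eq_zero h)
  have hpl : p.length ≠ 0 := fun h => hab (Walk.eq_of_length_eq_zero h).symm
  obtain ⟨z, c, hz, hc, hzc, hn⟩ := hG _
    (Walk.isCycle_cons_append_cons hq.isPath hp.isPath hqp hax hyb (.inl hab))
    (by simp only [Walk.length_cons, Walk.length_append]; omega)
  have hmem : ∀ t ∈ (Walk.cons hax (q.append (Walk.cons hyb p))).support,
      t ∈ q.support ∨ t ∈ p.support := by
    intro t ht
    rw [Walk.support_cons, List.mem_cons, Walk.mem_support_append_iff, Walk.support_cons,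
      List.mem_cons] at ht
    rcases ht with rfl | h | rfl | h
    · exact .inr p.end_mem_support
    · exact .inl h
    · exact .inl q.end_mem_support
    · exact .inr h
  rw [Walk.adj_toSubgraph_iff_mem_edges, Walk.edges_cons, Walk.edges_append, Walk.edges_cons,
    List.mem_cons, List.mem_append, List.mem_cons] at hn
  push Not at hn
  obtain ⟨h1, h2, h3, h4⟩ := hn
  rcases hmem z hz with hz | hz <;> rcases hmem c hc with hc | hc
  · exact absurd (hq.mem_edges hz hc hzc) h2
  · exact ⟨z, hz, c, hc, hzc, fun h => h1 (by rw [h.1, h.2, Sym2.eq_swap]),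
      fun h => h3 (by rw [h.1, h.2])⟩
  · exact ⟨c, hc, z, hz, hzc.symm, fun h => h1 (by rw [h.1, h.2]),
      fun h => h3 (by rw [h.1, h.2, Sym2.eq_swap])⟩
  · exact absurd (hp.mem_edges hz hc hzc) h4

/-- A vertex adjacent to both ends of a nontrivial walk in a convex set lies in that set. -/
theorem _root_.CcConvex.mem_of_adj_of_adj {T : Set V} (hT : CcConvex G T) {a b x : V}
    (p : G.Walk b a) (hp : ∀ z ∈ p.support, z ∈ T) (hab : a ≠ b) (hxa : G.Adj x a)
    (hxb : G.Adj x b) : x ∈ T := by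
  by_contra hx
  obtain ⟨p, hp⟩ := p.exists_isShortestIn hp
  have hc : (Walk.cons hxb (p.append (Walk.cons hxa.symm Walk.nil))).IsCycle :=
    Walk.isCycle_cons_append_cons hp.isPath (.nil (u := x))
      (fun z hz h => hx (Walk.mem_support_nil_iff.1 h ▸ hp.1 z hz)) hxb hxa.symm (.inr hab.symm)
  refine hx (hT ▸ Or.inr ⟨(Walk.cons hxb (p.append (Walk.cons hxa.symm Walk.nil))).induce
    (insert x T) ?_, ?_⟩)
  · intro z hz
    simp only [Walk.support_cons, List.mem_cons, Walk.mem_support_append_iff, Walk.support_nil,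
      List.not_mem_nil, or_false] at hz
    rcases hz with rfl | h | rfl | rfl
    · exact Set.mem_insert _ _
    · exact Set.mem_insert_of_mem _ (hp.1 z h)
    · exact Set.mem_insert_of_mem _ (hp.1 z p.end_mem_support)
    · exact Set.mem_insert _ _
  · rw [← Walk.isCycle_map_iff_of_injective (f := (Embedding.induce (G := G) _).toHom)
      Subtype.val_injective, Walk.map_induce]
    exact hc

/-- If every vertex outside a connected set `A` has at most one neighbour in `A`, then a chordal
graph has no walk outside `A` joining neighbours of distinct vertices of `A`. -/
theorem _root_.Chordal.eq_of_walk_compl (hG : Chordal G) {A : Set V}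
    (hA : ∀ a ∈ A, ∀ b ∈ A, ∃ p : G.Walk a b, ∀ z ∈ p.support, z ∈ A)
    (huniq : ∀ x ∉ A, ∀ a ∈ A, ∀ b ∈ A, G.Adj x a → G.Adj x b → a = b)
    {a b x y : V} (q : G.Walk x y) (hq : ∀ z ∈ q.support, z ∈ Aᶜ) (ha : a ∈ A) (hb : b ∈ A)
    (hxa : G.Adj x a) (hyb : G.Adj y b) : a = b := by
  classical
  by_contra hab
  have h : ∃ n, ∃ a ∈ A, ∃ b ∈ A, a ≠ b ∧ ∃ x y, ∃ q : G.Walk x y,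
      (∀ z ∈ q.support, z ∈ Aᶜ) ∧ G.Adj x a ∧ G.Adj y b ∧ q.length = n :=
    ⟨_, a, ha, b, hb, hab, x, y, q, hq, hxa, hyb, rfl⟩
  have hmin := fun m => Nat.find_min' (m := m) h
  obtain ⟨a, ha, b, hb, hab, x, y, q, hq, hxa, hyb, hn⟩ := Nat.find_spec h
  rw [← hn] at hmin
  obtain ⟨p, hp⟩ := hA b hb a ha
  obtain ⟨p, hp⟩ := p.exists_isShortestIn hp
  have hqs : q.IsShortestIn Aᶜ :=
    ⟨hq, fun r hr => hmin _ ⟨a, ha, b, hb, hab, x, y, r, hr, hxa, hyb, rfl⟩⟩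
  obtain ⟨z, hz, c, hc, hzc, h1, h2⟩ := hG.exists_adj_between hqs hp
    (fun z hz h => hq z hz (hp.1 z h)) hxa.symm hyb hab
    (by rintro rfl; exact hab (huniq x (hq x q.start_mem_support) a ha b hb hxa hyb))
  replace hc := hp.1 c hc
  by_cases hca : c = a
  · subst hca
    refine h1 ⟨?_, rfl⟩
    by_contra hzx
    have := hmin _ ⟨c, hc, b, hb, hab, z, y, q.dropUntil z hz,
      fun t ht => hq t (q.support_dropUntil_subset_support hz ht), hzc, hyb, rfl⟩
    have := Walk.length_dropUntil_lt_length hz hzx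
    omega
  · have hzy : z = y := by
      by_contra hzy
      have := hmin _ ⟨a, ha, c, hc, Ne.symm hca, x, z, q.takeUntil z hz,
        fun t ht => hq t (q.support_takeUntil_subset_support hz ht), hxa, hzc, rfl⟩
      have := Walk.length_takeUntil_lt_length hz hzy
      omega
    subst hzy
    exact h2 ⟨rfl, huniq z (hq z hz) c hc b hb hzc hyb⟩

end SimpleGraph

/-- In a 2-connected chordal graph, any edge `uv` gives a hull set `{u, v}` in the
cycle convexity. 2-connected: connected, at least 3 vertices, and no cut-vertex. -/
theorem twoConnected_chordal_edge_hullSet {V : Type*} [Fintype V] (G : SimpleGraph V)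
    (hchordal : Chordal G) (hconn : G.Connected) (hcard : 3 ≤ Fintype.card V)
    (hnocut : ∀ v : V, Nat.card ((G.induce ({v}ᶜ : Set V)).ConnectedComponent) ≤ 1)
    (u v : V) (huv : G.Adj u v) :
    ccHull G {u, v} = Set.univ := by
  classical
  refine Set.eq_univ_of_forall fun t => Set.mem_sInter.2 fun T ⟨hTs, hT⟩ => ?_
  have hu : u ∈ T := hTs (by simp)
  have hv : v ∈ T := hTs (by simp)
  let A : Set V := {z | ∃ p : G.Walk u z, ∀ s ∈ p.support, s ∈ T}
  have hAT : A ⊆ T := fun z ⟨p, hp⟩ => hp z p.end_mem_support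
  have hAsupp : ∀ z (p : G.Walk u z), (∀ s ∈ p.support, s ∈ T) → ∀ s ∈ p.support, s ∈ A :=
    fun z p hp s hs =>
      ⟨p.takeUntil s hs, fun r hr => hp r (p.support_takeUntil_subset_support hs hr)⟩
  have hA : ∀ a ∈ A, ∀ b ∈ A, ∃ p : G.Walk a b, ∀ z ∈ p.support, z ∈ A := by
    rintro a ⟨p, hp⟩ b ⟨q, hq⟩
    refine ⟨p.reverse.append q, fun z hz => ?_⟩
    rw [Walk.mem_support_append_iff, Walk.support_reverse, List.mem_reverse] at hz
    exact hz.elim (hAsupp a p hp z) (hAsupp b q hq z)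
  have huA : u ∈ A := ⟨.nil, by simpa using hu⟩
  have hvA : v ∈ A := ⟨.cons huv .nil, by simp [hu, hv]⟩
  have huniq : ∀ x ∉ A, ∀ a ∈ A, ∀ b ∈ A, G.Adj x a → G.Adj x b → a = b := by
    intro x hx a ha b hb hxa hxb
    by_contra hab
    obtain ⟨p, hp⟩ := hA b hb a ha
    have hxT := hT.mem_of_adj_of_adj p (fun z hz => hAT (hp z hz)) hab hxa hxb
    obtain ⟨r, hr⟩ := ha
    refine hx ⟨r.concat hxa.symm, fun s hs => ?_⟩
    rw [Walk.support_concat, List.mem_append, List.mem_singleton] at hs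
    exact hs.elim (hr s) fun h => h ▸ hxT
  by_contra ht
  obtain ⟨w⟩ := hconn.preconnected t u
  obtain ⟨x, a, q, hq, hxa, ha, -⟩ := w.exists_walk_compl_adj (fun h => ht (hAT h)) huA
  have hx : x ∉ A := hq x q.end_mem_support
  obtain ⟨b, hb, hba⟩ : ∃ b ∈ A, b ≠ a := by
    by_cases h : u = a
    · exact ⟨v, hvA, fun h' => huv.ne (h.trans h'.symm)⟩
    · exact ⟨u, huA, h⟩
  have hsub := Finite.card_le_one_iff_subsingleton.1 (hnocut a)
  obtain ⟨w⟩ := ConnectedComponent.exact (Subsingleton.elim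
    ((G.induce ({a}ᶜ : Set V)).connectedComponentMk ⟨x, fun h => hx (h ▸ ha)⟩)
    ((G.induce ({a}ᶜ : Set V)).connectedComponentMk ⟨b, hba⟩))
  obtain ⟨y, c, q, hq, hyc, hc, hcw⟩ :=
    (w.map (Embedding.induce _).toHom).exists_walk_compl_adj (A := A) hx hb
  have hac : a = c := hchordal.eq_of_walk_compl hA huniq q hq ha hc hxa hyc
  rw [Walk.support_map, List.mem_map] at hcw
  obtain ⟨d, -, hd⟩ := hcw
  exact d.2 (hd.trans hac.symm)
end

section
/- Let G = G_{m,n} be the m × n grid graph. A set S ⊆ V(G) is convex in the cycle convexity if, and only if, S is boxed, i.e. the vertex set of every connected component of the subgraph of G induced by S is of the form {a, a+1, …, b} × {c, c+1, …, d} for some 1 ≤ a ≤ b ≤ m and 1 ≤ c ≤ d ≤ n. -/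
open SimpleGraph

/-- The `m × n` grid graph: vertices are pairs `(i, j)` with `i < m`, `j < n`, and two
vertices are adjacent iff their coordinates are at `ℓ₁`-distance one. -/
def gridGraph (m n : ℕ) : SimpleGraph (Fin m × Fin n) :=
  SimpleGraph.fromRel (fun p q => Nat.dist p.1.val q.1.val + Nat.dist p.2.val q.2.val = 1)

section CycleConvexity

variable {V : Type*} {G : SimpleGraph V} {S : Set V}

/-- A vertex outside `S` with two neighbours in one component of `G[S]` lies in `Icc G S`. -/
theorem mem_Icc_of_reachable {v : V} (hv : v ∉ S) {x y : S} (hxy : x ≠ y)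
    (hvx : G.Adj v x) (hvy : G.Adj v y) (h : (G.induce S).Reachable x y) : v ∈ Icc G S := by
  right
  obtain ⟨p, hp⟩ := h.exists_isPath
  let f := G.induceHomOfLE (Set.subset_insert v S)
  let v' : ↥(insert v S) := ⟨v, Set.mem_insert v S⟩
  have hfv : v' ∉ (p.map f.toHom).support := by
    rw [Walk.support_map, List.mem_map]
    rintro ⟨z, -, hz⟩
    have hzv : z.1 = v := congrArg Subtype.val hz
    exact hv (hzv ▸ z.2)
  have hyv : (G.induce (insert v S)).Adj (f y) v' := hvy.symm
  have hvx' : (G.induce (insert v S)).Adj v' (f x) := hvx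
  refine ⟨Walk.cons hvx' ((p.map f.toHom).concat hyv), (Walk.cons_isCycle_iff _ _).2 ⟨?_, ?_⟩⟩
  · exact (hp.map f.injective).concat hfv hyv
  · rw [Walk.edges_concat, List.concat_eq_append, List.mem_append, List.mem_singleton]
    rintro (h | h)
    · exact hfv (Walk.fst_mem_support_of_mem_edges _ h)
    · rw [Sym2.eq_swap, Sym2.congr_left] at h
      exact hxy (f.injective h)

/-- A vertex that `Icc G S` adds to `S` has two neighbours in one component of `G[S]`. -/
theorem exists_reachable_of_mem_Icc {v : V} (hv : v ∉ S) (h : v ∈ Icc G S) :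
    ∃ x y : S, x ≠ y ∧ G.Adj v x ∧ G.Adj v y ∧ (G.induce S).Reachable x y := by
  obtain ⟨c, hc⟩ := h.resolve_left hv
  cases c with
  | nil => exact absurd rfl hc.ne_nil
  | @cons _ x _ hvx p =>
    obtain ⟨hp, he⟩ := (Walk.cons_isCycle_iff _ _).1 hc
    have hr := hp.reverse
    have he' : s(⟨v, Set.mem_insert v S⟩, x) ∉ p.reverse.edges := by simpa using he
    generalize p.reverse = q at hr he'
    cases q with
    | nil => exact absurd hvx (SimpleGraph.irrefl _)
    | @cons _ y _ hvy q =>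
      obtain ⟨-, hvq⟩ := (Walk.cons_isPath_iff _ _).1 hr
      have hq : ∀ z ∈ (q.map (Embedding.induce (insert v S)).toHom).support, z ∈ S := by
        intro z hz
        obtain ⟨w, hwq, rfl⟩ := List.mem_map.1 (Walk.support_map _ _ ▸ hz)
        refine w.2.resolve_left fun hwv => hvq ?_
        rwa [← show w = ⟨v, Set.mem_insert v S⟩ from Subtype.ext hwv]
      refine ⟨⟨x, hq _ (Walk.end_mem_support _)⟩, ⟨y, hq _ (Walk.start_mem_support _)⟩, ?_,
        hvx, hvy, ⟨(Walk.induce S _ hq).reverse⟩⟩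
      intro hxy
      obtain rfl : x = y := Subtype.ext (Subtype.mk.inj hxy)
      simp at he'

/-- `S` is convex iff it contains every vertex with two neighbours in one component of `G[S]`. -/
theorem ccConvex_iff : CcConvex G S ↔ ∀ v, ∀ x y : S, x ≠ y → G.Adj v x → G.Adj v y →
    (G.induce S).Reachable x y → v ∈ S := by
  refine ⟨fun h v x y hxy hvx hvy hr => ?_, fun h => ?_⟩
  · by_contra hv
    exact hv ((congrArg (v ∈ ·) h).mp (mem_Icc_of_reachable hv hxy hvx hvy hr))
  · refine Set.Subset.antisymm (fun v hv => ?_) Set.subset_union_left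
    by_contra hvS
    obtain ⟨x, y, hxy, hvx, hvy, hr⟩ := exists_reachable_of_mem_Icc hvS hv
    exact hvS (h v x y hxy hvx hvy hr)

end CycleConvexity

theorem gridGraph_adj {m n : ℕ} {p q : Fin m × Fin n} : (gridGraph m n).Adj p q ↔
    (p.1.val = q.1.val ∧ (p.2.val + 1 = q.2.val ∨ q.2.val + 1 = p.2.val)) ∨
    (p.2.val = q.2.val ∧ (p.1.val + 1 = q.1.val ∨ q.1.val + 1 = p.1.val)) := by
  simp only [gridGraph, SimpleGraph.fromRel_adj, Nat.dist, ne_eq, Prod.ext_iff, Fin.ext_iff]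
  omega

/-- Corner closure spreads one cell along a line adjacent to a full segment. -/
theorem forall_of_corner_closed {P : ℕ → ℕ → Prop} {x x' c d j : ℕ}
    (hP : ∀ y y', P x y → P x' y' → (y + 1 = y' ∨ y' + 1 = y) → P x' y)
    (hx : ∀ y, c ≤ y → y ≤ d → P x y) (hcj : c ≤ j) (hjd : j ≤ d) (hj : P x' j) :
    ∀ y, c ≤ y → y ≤ d → P x' y := by
  have up : ∀ k, j + k ≤ d → P x' (j + k) := by
    intro k
    induction k with
    | zero => exact fun _ => hj
    | succ k ih =>
      intro hk
      exact hP _ _ (hx _ (by omega) hk) (ih (by omega)) (Or.inr rfl)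
  have down : ∀ k, c + k ≤ j → P x' (j - k) := by
    intro k
    induction k with
    | zero => exact fun _ => hj
    | succ k ih =>
      intro hk
      exact hP _ _ (hx _ (by omega) (by omega)) (ih (by omega)) (Or.inl (by omega))
  intro y hcy hyd
  rcases le_total j y with h | h
  · simpa [Nat.add_sub_cancel' h] using up (y - j) (by omega)
  · simpa [Nat.sub_sub_self h] using down (j - y) (by omega)

/-- A nonempty bounded subset of `ℕ × ℕ` that is connected (every proper sub-box has a neighbouring
cell in the set) and closed under filling corners is a box. -/
theorem exists_box_of_corner_closed {P : ℕ → ℕ → Prop} {m n : ℕ}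
    (hb : ∀ i j, P i j → i < m ∧ j < n) (hne : ∃ i j, P i j)
    (hcorner : ∀ i j i' j', P i j → P i' j' → (i + 1 = i' ∨ i' + 1 = i) →
      (j + 1 = j' ∨ j' + 1 = j) → P i j')
    (hconn : ∀ Q : ℕ → ℕ → Prop, (∃ i j, P i j ∧ Q i j) → (∃ i j, P i j ∧ ¬ Q i j) →
      ∃ i j i' j', Q i j ∧ P i' j' ∧ ¬ Q i' j' ∧
        ((i = i' ∧ (j + 1 = j' ∨ j' + 1 = j)) ∨ (j = j' ∧ (i + 1 = i' ∨ i' + 1 = i)))) :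
    ∃ a b c d : ℕ, a ≤ b ∧ c ≤ d ∧ ∀ i j, P i j ↔ a ≤ i ∧ i ≤ b ∧ c ≤ j ∧ j ≤ d := by
  by_contra! hno
  have grow : ∀ k, ∃ a b c d : ℕ, a ≤ b ∧ c ≤ d ∧ (b - a) + (d - c) = k ∧
      ∀ i j, a ≤ i → i ≤ b → c ≤ j → j ≤ d → P i j := by
    intro k
    induction k with
    | zero =>
      obtain ⟨i, j, h⟩ := hne
      refine ⟨i, i, j, j, le_rfl, le_rfl, by omega, fun i' j' h1 h2 h3 h4 => ?_⟩
      rwa [← le_antisymm h1 h2, ← le_antisymm h3 h4]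
    | succ k ih =>
      obtain ⟨a, b, c, d, hab, hcd, hk, hB⟩ := ih
      have hout : ∃ i j, P i j ∧ ¬ (a ≤ i ∧ i ≤ b ∧ c ≤ j ∧ j ≤ d) := by
        obtain ⟨i, j, h⟩ := hno a b c d hab hcd
        rcases h with h | ⟨h, h1, h2, h3, h4⟩
        · exact ⟨i, j, h.1, by have := h.2; omega⟩
        · exact absurd (hB i j h1 h2 h3 h4) h
      obtain ⟨i, j, i', j', hQ, hP', hQ', hadj⟩ :=
        hconn (fun i j => a ≤ i ∧ i ≤ b ∧ c ≤ j ∧ j ≤ d)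
          ⟨a, c, hB a c le_rfl hab le_rfl hcd, by omega⟩ hout
      rcases hadj with ⟨rfl, hj⟩ | ⟨rfl, hi⟩
      · have col := forall_of_corner_closed (P := fun y x => P x y) (x := j) (x' := j')
          (fun y y' h1 h2 h3 => hcorner _ _ _ _ h1 h2 h3 hj)
          (fun y h1 h2 => hB y j h1 h2 hQ.2.2.1 hQ.2.2.2) hQ.1 hQ.2.1 hP'
        refine ⟨a, b, min c j', max d j', hab, by omega, by omega, fun x y h1 h2 h3 h4 => ?_⟩
        by_cases hy : y = j'
        · exact hy ▸ col x h1 h2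
        · exact hB x y h1 h2 (by omega) (by omega)
      · have row := forall_of_corner_closed (P := P) (x := i) (x' := i')
          (fun y y' h1 h2 h3 => hcorner _ _ _ _ h2 h1 (by omega) (by omega))
          (fun y h1 h2 => hB i y hQ.1 hQ.2.1 h1 h2) hQ.2.2.1 hQ.2.2.2 hP'
        refine ⟨min a i', max b i', c, d, by omega, hcd, by omega, fun x y h1 h2 h3 h4 => ?_⟩
        by_cases hx : x = i'
        · exact hx ▸ row y h3 h4
        · exact hB x y (by omega) (by omega) h3 h4
  obtain ⟨a, b, c, d, hab, hcd, hk, hB⟩ := grow (m + n)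
  have := hb b d (hB b d hab le_rfl hcd le_rfl)
  omega

/-- A set of vertices of the grid is convex in the cycle convexity iff it is boxed,
i.e. every connected component of the induced subgraph is a subgrid
`{a, …, b} × {c, …, d}`. -/
theorem grid_ccConvex_iff_boxed (m n : ℕ) (S : Set (Fin m × Fin n)) :
    CcConvex (gridGraph m n) S ↔
      ∀ K : ((gridGraph m n).induce S).ConnectedComponent,
        ∃ a b c d : ℕ, a ≤ b ∧ c ≤ d ∧
          Subtype.val '' K.supp =
            {p : Fin m × Fin n | a ≤ p.1.val ∧ p.1.val ≤ b ∧ c ≤ p.2.val ∧ p.2.val ≤ d} := by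
  rw [ccConvex_iff]
  constructor
  · intro hS K
    let P : ℕ → ℕ → Prop := fun i j => ∃ (hi : i < m) (hj : j < n),
      ((⟨i, hi⟩, ⟨j, hj⟩) : Fin m × Fin n) ∈ Subtype.val '' K.supp
    have hcorner : ∀ i j i' j', P i j → P i' j' → (i + 1 = i' ∨ i' + 1 = i) →
        (j + 1 = j' ∨ j' + 1 = j) → P i j' := by
      rintro i j i' j' ⟨hi, hj, x, hx, hxe⟩ ⟨hi', hj', y, hy, hye⟩ h1 h2
      let v : Fin m × Fin n := (⟨i, hi⟩, ⟨j', hj'⟩)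
      have hvx : (gridGraph m n).Adj v x := by
        rw [hxe, gridGraph_adj]; exact Or.inl ⟨rfl, h2.symm⟩
      have hvy : (gridGraph m n).Adj v y := by
        rw [hye, gridGraph_adj]; exact Or.inr ⟨rfl, h1⟩
      have hxy : x ≠ y := by
        rintro rfl
        have := hxe.symm.trans hye
        simp only [Prod.mk.injEq, Fin.mk.injEq] at this
        omega
      have hv : v ∈ S := hS v x y hxy hvx hvy (ConnectedComponent.exact (hx.trans hy.symm))
      have hadj : ((gridGraph m n).induce S).Adj ⟨v, hv⟩ x := hvx
      exact ⟨hi, hj', ⟨v, hv⟩, (ConnectedComponent.sound hadj.reachable).trans hx, rfl⟩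
    have hconn : ∀ Q : ℕ → ℕ → Prop, (∃ i j, P i j ∧ Q i j) → (∃ i j, P i j ∧ ¬ Q i j) →
        ∃ i j i' j', Q i j ∧ P i' j' ∧ ¬ Q i' j' ∧
          ((i = i' ∧ (j + 1 = j' ∨ j' + 1 = j)) ∨ (j = j' ∧ (i + 1 = i' ∨ i' + 1 = i))) := by
      rintro Q ⟨i, j, ⟨hi, hj, x, hx, hxe⟩, hQ⟩ ⟨i', j', ⟨hi', hj', y, hy, hye⟩, hQ'⟩
      obtain ⟨p⟩ : ((gridGraph m n).induce S).Reachable x y :=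
        ConnectedComponent.exact (hx.trans hy.symm)
      obtain ⟨e, he, h1, h2⟩ := p.exists_boundary_dart {z | Q z.1.1.val z.1.2.val}
        (by simpa [hxe] using hQ) (by simpa [hye] using hQ')
      have hK : e.snd ∈ K.supp := by
        rw [ConnectedComponent.mem_supp_iff, ← (ConnectedComponent.mem_supp_iff K x).1 hx]
        exact ConnectedComponent.sound
          (p.takeUntil _ (p.dart_snd_mem_support_of_mem_darts he)).reachable.symm
      exact ⟨_, _, _, _, h1, ⟨e.snd.1.1.2, e.snd.1.2.2, e.snd, hK, rfl⟩, h2,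
        gridGraph_adj.1 e.adj⟩
    have hne : ∃ i j, P i j := by
      obtain ⟨x, hx⟩ := K.nonempty_supp
      exact ⟨_, _, x.1.1.2, x.1.2.2, x, hx, rfl⟩
    obtain ⟨a, b, c, d, hab, hcd, h⟩ :=
      exists_box_of_corner_closed (fun i j ⟨hi, hj, _⟩ => ⟨hi, hj⟩) hne hcorner hconn
    refine ⟨a, b, c, d, hab, hcd, Set.ext fun p => ?_⟩
    rw [Set.mem_ofPred_eq, ← h]
    exact ⟨fun hp => ⟨p.1.2, p.2.2, hp⟩, fun ⟨_, _, hp⟩ => hp⟩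
  · intro hS v x y hxy hvx hvy hr
    obtain ⟨a, b, c, d, -, -, h⟩ := hS (connectedComponentMk _ x)
    have hx := h.subset ⟨x, rfl, rfl⟩
    have hy := h.subset ⟨y, ConnectedComponent.sound hr.symm, rfl⟩
    have hv : v ∈ {p : Fin m × Fin n | a ≤ p.1.val ∧ p.1.val ≤ b ∧ c ≤ p.2.val ∧ p.2.val ≤ d} := by
      have hne : x.1 ≠ y.1 := fun h => hxy (Subtype.ext h)
      rw [gridGraph_adj] at hvx hvy
      rw [ne_eq, Prod.ext_iff, Fin.ext_iff, Fin.ext_iff] at hne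
      simp only [Set.mem_ofPred_eq] at hx hy ⊢
      omega
    obtain ⟨w, -, rfl⟩ := h.superset hv
    exact w.2
end

section
/- In the m × n grid graph G_{m,n}, every row L_i = {(i,j) : 1 ≤ j ≤ n} (for each i with 1 ≤ i ≤ m) and every column C_j = {(i,j) : 1 ≤ i ≤ m} (for each j with 1 ≤ j ≤ n) is a co-convex set in the cycle convexity. -/
open SimpleGraph

namespace SimpleGraph

/-- If a predicate is constant along the edges avoiding `v`, a walk from `u ≠ v` to `v` first
reaches `v` from a vertex where the predicate agrees with its value at `u`. -/
lemma Walk.exists_mem_edges_iff_of_ne {W : Type*} {H : SimpleGraph W} {P : W → Prop} {u v : W}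
    (hP : ∀ a b, H.Adj a b → a ≠ v → b ≠ v → (P a ↔ P b)) (p : H.Walk u v) (hu : u ≠ v) :
    ∃ x, H.Adj v x ∧ (P u ↔ P x) ∧ s(v, x) ∈ p.edges := by
  induction p with
  | nil => exact absurd rfl hu
  | @cons a b c h q ih =>
    by_cases hb : b = c
    · subst hb
      exact ⟨a, h.symm, Iff.rfl, by simp [Sym2.eq_swap]⟩
    · obtain ⟨x, hx, hPx, hmem⟩ := ih hP hb
      exact ⟨x, hx, (hP a b h hu hb).trans hPx, by simp [hmem]⟩

/-- A vertex whose neighbours are separated by a predicate that is constant along the edges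
avoiding it lies on no cycle. -/
lemma Walk.not_isCycle_of_separated {W : Type*} {H : SimpleGraph W} {P : W → Prop} {v : W}
    (hP : ∀ a b, H.Adj a b → a ≠ v → b ≠ v → (P a ↔ P b))
    (hN : ∀ a b, H.Adj v a → H.Adj v b → (P a ↔ P b) → a = b) (w : H.Walk v v) :
    ¬ w.IsCycle := by
  intro hw
  cases w with
  | nil => exact Walk.not_isCycle_nil hw
  | cons h p =>
    obtain ⟨x, hx, hPx, hmem⟩ := p.exists_mem_edges_iff_of_ne hP h.ne'
    obtain rfl := hN _ _ h hx hPx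
    exact ((Walk.cons_isCycle_iff p h).1 hw).2 hmem

end SimpleGraph

/-- A set is convex if each outside vertex has its neighbours in the set separated by a predicate
that is constant along the edges of the set. -/
lemma ccConvex_of_separated {V : Type*} {G : SimpleGraph V} {S : Set V} (P : V → Prop)
    (hP : ∀ a ∈ S, ∀ b ∈ S, G.Adj a b → (P a ↔ P b))
    (hN : ∀ v ∉ S, ∀ a ∈ S, ∀ b ∈ S, G.Adj v a → G.Adj v b → (P a ↔ P b) → a = b) :
    CcConvex G S := by
  refine Set.union_eq_left.2 ?_
  rintro v ⟨w, hw⟩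
  by_contra hv
  have mem_of_ne : ∀ a : ↥(insert v S), a ≠ ⟨v, Set.mem_insert v S⟩ → a.1 ∈ S := fun a ha =>
    a.2.resolve_left fun h => ha (Subtype.ext h)
  refine Walk.not_isCycle_of_separated (P := fun a => P a.1) ?_ ?_ w hw
  · exact fun a b hab ha hb => hP _ (mem_of_ne a ha) _ (mem_of_ne b hb) hab
  · exact fun a b ha hb h =>
      Subtype.ext (hN v hv _ (mem_of_ne a ha.ne') _ (mem_of_ne b hb.ne') ha hb h)

lemma gridGraph_adj_dist {m n : ℕ} {p q : Fin m × Fin n} (h : (gridGraph m n).Adj p q) :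
    Nat.dist p.1.val q.1.val + Nat.dist p.2.val q.2.val = 1 := by
  rcases ((SimpleGraph.fromRel_adj _ _ _).1 h).2 with h | h
  · exact h
  · rwa [Nat.dist_comm p.1.val, Nat.dist_comm p.2.val]

/-- Every row and every column of the `m × n` grid is a co-convex set in the cycle
convexity (its complement is convex). -/
theorem grid_rows_columns_coconvex (m n : ℕ) :
    (∀ i : Fin m, CcConvex (gridGraph m n) ({p : Fin m × Fin n | p.1 = i}ᶜ)) ∧
    (∀ j : Fin n, CcConvex (gridGraph m n) ({p : Fin m × Fin n | p.2 = j}ᶜ)) := by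
  constructor
  · intro i
    refine ccConvex_of_separated (fun p => p.1.val < i.val) ?_ ?_
    · intro a ha b hb hab
      have h := gridGraph_adj_dist hab
      simp only [Set.mem_compl_iff, Set.mem_ofPred_eq, Fin.ext_iff, Nat.dist] at ha hb h
      omega
    · intro v hv a ha b hb hva hvb hab
      have h₁ := gridGraph_adj_dist hva
      have h₂ := gridGraph_adj_dist hvb
      simp only [Set.mem_compl_iff, Set.mem_ofPred_eq, Fin.ext_iff, Nat.dist, not_not]
        at hv ha hb h₁ h₂
      ext <;> omega
  · intro j
    refine ccConvex_of_separated (fun p => p.2.val < j.val) ?_ ?_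
    · intro a ha b hb hab
      have h := gridGraph_adj_dist hab
      simp only [Set.mem_compl_iff, Set.mem_ofPred_eq, Fin.ext_iff, Nat.dist] at ha hb h
      omega
    · intro v hv a ha b hb hva hvb hab
      have h₁ := gridGraph_adj_dist hva
      have h₂ := gridGraph_adj_dist hvb
      simp only [Set.mem_compl_iff, Set.mem_ofPred_eq, Fin.ext_iff, Nat.dist, not_not]
        at hv ha hb h₁ h₂
      ext <;> omega
end

section
/- In the m × n grid graph G_{m,n} (with m, n ≥ 1), the union of the first row and the first column, namely S = {(1,j) : 1 ≤ j ≤ n} ∪ {(i,1) : 1 ≤ i ≤ m}, is a hull set of G_{m,n} in the cycle convexity; in particular hn_cc(G_{m,n}) ≤ m + n − 1. -/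
open SimpleGraph

/-- A vertex completing a 4-cycle with three vertices of a convex set belongs to that set. -/
lemma CcConvex.mem_of_four_cycle {V : Type*} {G : SimpleGraph V} {T : Set V}
    (hT : CcConvex G T) {v a b c : V} (ha : a ∈ T) (hb : b ∈ T) (hc : c ∈ T)
    (hva : G.Adj v a) (hab : G.Adj a b) (hbc : G.Adj b c) (hcv : G.Adj c v)
    (hac : a ≠ c) (hvb : v ≠ b) : v ∈ T := by
  rw [← hT]
  right
  let H := G.induce (insert v T)
  let v' : ↥(insert v T) := ⟨v, Set.mem_insert v T⟩
  let a' : ↥(insert v T) := ⟨a, Set.mem_insert_of_mem v ha⟩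
  let b' : ↥(insert v T) := ⟨b, Set.mem_insert_of_mem v hb⟩
  let c' : ↥(insert v T) := ⟨c, Set.mem_insert_of_mem v hc⟩
  have h₁ : H.Adj v' a' := hva
  have h₂ : H.Adj a' b' := hab
  have h₃ : H.Adj b' c' := hbc
  have h₄ : H.Adj c' v' := hcv
  refine ⟨Walk.cons h₁ (Walk.cons h₂ (Walk.cons h₃ (Walk.cons h₄ Walk.nil))), ?_⟩
  rw [Walk.cons_isCycle_iff]
  have := hva.ne
  have := hab.ne
  have := hbc.ne
  have := hcv.ne
  simp [v', a', b', c', Walk.isPath_def]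
  grind

lemma gridGraph_adj_iff {m n : ℕ} {p q : Fin m × Fin n} :
    (gridGraph m n).Adj p q ↔ Nat.dist p.1.val q.1.val + Nat.dist p.2.val q.2.val = 1 := by
  simp only [gridGraph, fromRel_adj, Nat.dist_comm q.1.val, Nat.dist_comm q.2.val, or_self,
    and_iff_right_iff_imp]
  rintro h rfl
  simp at h

/-- The first row and the first column of a grid lie in no proper convex set. -/
lemma gridGraph_mem_of_ccConvex {m n : ℕ} {T : Set (Fin m × Fin n)}
    (hST : {p : Fin m × Fin n | p.1.val = 0 ∨ p.2.val = 0} ⊆ T)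
    (hT : CcConvex (gridGraph m n) T) (i j : ℕ) (hi : i < m) (hj : j < n) :
    ((⟨i, hi⟩, ⟨j, hj⟩) : Fin m × Fin n) ∈ T := by
  induction i generalizing j with
  | zero => exact hST (Or.inl rfl)
  | succ i ihi =>
    induction j with
    | zero => exact hST (Or.inr rfl)
    | succ j ihj =>
      refine hT.mem_of_four_cycle (ihi (j + 1) (by lia) hj) (ihi j (by lia) (by lia))
        (ihj (by lia)) ?_ ?_ ?_ ?_ ?_ ?_ <;>
      simp [gridGraph_adj_iff, Nat.dist]

lemma gridGraph_isHullSet_first_row_column (m n : ℕ) :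
    IsHullSet (gridGraph m n) {p : Fin m × Fin n | p.1.val = 0 ∨ p.2.val = 0} :=
  Set.eq_univ_of_forall fun ⟨i, j⟩ _ hT ↦
    gridGraph_mem_of_ccConvex hT.1 hT.2 i.val j.val i.isLt j.isLt

lemma ncard_first_row_column_le (m n : ℕ) :
    {p : Fin m × Fin n | p.1.val = 0 ∨ p.2.val = 0}.ncard ≤ m + n - 1 := by
  rw [← Finset.card_range (m + n - 1), ← Set.ncard_coe_finset]
  refine Set.ncard_le_ncard_of_injOn
    (fun p ↦ if p.1.val = 0 then p.2.val else n - 1 + p.1.val) ?_ ?_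
  · rintro ⟨i, j⟩ -
    simp only [Finset.coe_range, Set.mem_Iio]
    have := i.isLt
    have := j.isLt
    split_ifs <;> lia
  · rintro ⟨i, j⟩ hp ⟨k, l⟩ hq h
    simp only [Set.mem_ofPred_eq] at hp hq h
    simp only [Prod.mk.injEq, Fin.ext_iff]
    split_ifs at h <;> lia

/-- The union of the first row and the first column of the `m × n` grid is a hull set in
the cycle convexity; in particular `hn_cc(G_{m,n}) ≤ m + n - 1`. -/
theorem grid_first_row_column_hullSet (m n : ℕ) (hm : 1 ≤ m) (hn : 1 ≤ n) :
    IsHullSet (gridGraph m n) {p : Fin m × Fin n | p.1.val = 0 ∨ p.2.val = 0} ∧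
    hnCC (gridGraph m n) ≤ m + n - 1 := by
  refine ⟨gridGraph_isHullSet_first_row_column m n, ?_⟩
  refine le_trans (Nat.sInf_le ?_) (ncard_first_row_column_le m n)
  exact ⟨_, rfl, gridGraph_isHullSet_first_row_column m n⟩
end

section
/- Let G be a finite simple graph that is a spider with partition (K, S, R). Then hn_cc(G) = 2 if |K| ≥ 3 and G is a fat spider, and hn_cc(G) = 2 + |S| otherwise. -/
open SimpleGraph

/-- `G` is a thin spider with partition `(K, S, R)`: there is a bijection `f : S → K`
with `N(s) = {f s}` for every `s ∈ S`. -/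
def IsThinSpider {V : Type*} (G : SimpleGraph V) (K S : Set V) : Prop :=
  ∃ f : V → V, Set.BijOn f S K ∧ ∀ s ∈ S, G.neighborSet s = {f s}

/-- `G` is a fat spider with partition `(K, S, R)`: there is a bijection `f : S → K`
with `N(s) = K \ {f s}` for every `s ∈ S`. -/
def IsFatSpider {V : Type*} (G : SimpleGraph V) (K S : Set V) : Prop :=
  ∃ f : V → V, Set.BijOn f S K ∧ ∀ s ∈ S, G.neighborSet s = K \ {f s}

/-- `G` is a spider with partition `(K, S, R)`: `K, S, R` partition `V`,
`|K| = |S| ≥ 2`, `K` is a clique, `S` is a stable set, every vertex of `R` is adjacent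
to every vertex of `K` and to no vertex of `S`, and `G` is thin or fat. -/
def IsSpider {V : Type*} (G : SimpleGraph V) (K S R : Set V) : Prop :=
  K ∪ S ∪ R = Set.univ ∧ Disjoint K S ∧ Disjoint K R ∧ Disjoint S R ∧
  K.ncard = S.ncard ∧ 2 ≤ K.ncard ∧
  G.IsClique K ∧ (∀ x ∈ S, ∀ y ∈ S, ¬ G.Adj x y) ∧
  (∀ r ∈ R, ∀ k ∈ K, G.Adj r k) ∧ (∀ r ∈ R, ∀ s ∈ S, ¬ G.Adj r s) ∧
  (IsThinSpider G K S ∨ IsFatSpider G K S)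

section CycleConvexity

variable {V : Type*} {G : SimpleGraph V} {T : Set V}

theorem ccHull_eq_self (h : CcConvex G T) : ccHull G T = T :=
  Set.Subset.antisymm (Set.sInter_subset_of_mem ⟨subset_rfl, h⟩)
    (Set.subset_sInter fun _ hU => hU.1)

/-- A convex set containing two vertices of a triangle contains the third one. -/
theorem CcConvex.mem_of_triangle (h : CcConvex G T) {a b v : V} (ha : a ∈ T) (hb : b ∈ T)
    (hab : G.Adj a b) (hva : G.Adj v a) (hvb : G.Adj v b) : v ∈ T := by
  rw [← h]
  refine Or.inr ?_
  let v' : (insert v T : Set V) := ⟨v, Set.mem_insert v T⟩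
  let a' : (insert v T : Set V) := ⟨a, Set.mem_insert_of_mem v ha⟩
  let b' : (insert v T : Set V) := ⟨b, Set.mem_insert_of_mem v hb⟩
  have h₁ : (G.induce (insert v T)).Adj v' a' := hva
  have h₂ : (G.induce (insert v T)).Adj a' b' := hab
  have h₃ : (G.induce (insert v T)).Adj b' v' := hvb.symm
  refine ⟨.cons h₁ (.cons h₂ (.cons h₃ .nil)), ?_⟩
  rw [Walk.cons_isCycle_iff]
  have := h₁.ne
  have := h₂.ne
  have := h₃.ne
  constructor
  · simp [Walk.cons_isPath_iff]
    grind
  · simp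
    grind

/-- The vertex set of a cycle witnessing `v ∈ Icc G T` induces a subgraph of minimum degree
at least two. -/
theorem exists_two_neighbors_of_mem_Icc {v : V} (hv : v ∈ Icc G T) (hvT : v ∉ T) :
    ∃ C ⊆ insert v T, v ∈ C ∧
      ∀ u ∈ C, ∃ a ∈ C, ∃ b ∈ C, a ≠ b ∧ G.Adj u a ∧ G.Adj u b := by
  classical
  obtain ⟨w, hw⟩ := hv.resolve_left hvT
  refine ⟨Subtype.val '' {x | x ∈ w.support}, ?_, ⟨_, w.start_mem_support, rfl⟩, ?_⟩
  · rintro _ ⟨x, -, rfl⟩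
    exact x.2
  · rintro _ ⟨u, hu, rfl⟩
    have hc := Walk.IsCycle.rotate hu hw
    have hmem : ∀ x ∈ (w.rotate u hu).support, x ∈ w.support := fun x hx => by
      simpa using hx
    refine ⟨_, ⟨_, hmem _ (Walk.getVert_mem_support _ 1), rfl⟩,
      _, ⟨_, hmem _ (Walk.getVert_mem_support _ ((w.rotate u hu).length - 1)), rfl⟩,
      fun h => hc.snd_ne_penultimate (Subtype.ext h), ?_, ?_⟩
    · exact Walk.adj_snd hc.not_nil
    · exact (Walk.adj_penultimate hc.not_nil).symm

/-- If the vertices of `L` have degree at most one, a set with at most one vertex outside of `L`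
is convex. -/
theorem ccConvex_of_subsingleton_diff {L : Set V} (hL : ∀ s ∈ L, (G.neighborSet s).Subsingleton)
    (hT : (T \ L).Subsingleton) : CcConvex G T := by
  refine Set.Subset.antisymm (fun v hv => ?_) Set.subset_union_left
  by_contra hvT
  obtain ⟨C, hCT, hvC, hC⟩ := exists_two_neighbors_of_mem_Icc hv hvT
  have hCL : ∀ u ∈ C, u ∉ L := fun u hu huL => by
    obtain ⟨a, -, b, -, hab, ha, hb⟩ := hC u hu
    exact hab (hL u huL ha hb)
  obtain ⟨a, haC, b, hbC, hab, ha, hb⟩ := hC v hvC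
  exact hab (hT ⟨(hCT haC).resolve_left ha.ne', hCL a haC⟩
    ⟨(hCT hbC).resolve_left hb.ne', hCL b hbC⟩)

/-- A hull set contains every vertex of degree at most one. -/
theorem IsHullSet.mem_of_subsingleton_neighborSet (hT : IsHullSet G T) {s : V}
    (hs : (G.neighborSet s).Subsingleton) : s ∈ T := by
  by_contra hsT
  have hconv : CcConvex G {s}ᶜ := by
    refine Set.Subset.antisymm (fun v hv => ?_) Set.subset_union_left
    by_contra hvs
    obtain ⟨C, -, hvC, hC⟩ := exists_two_neighbors_of_mem_Icc hv hvs
    obtain rfl : v = s := by simpa using hvs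
    obtain ⟨a, -, b, -, hab, ha, hb⟩ := hC v hvC
    exact hab (hs ha hb)
  have hmem : s ∈ ccHull G T := hT ▸ Set.mem_univ s
  exact hmem {s}ᶜ ⟨Set.subset_compl_singleton_iff.2 hsT, hconv⟩ rfl

theorem IsHullSet.two_add_ncard_le [Finite V] (hT : IsHullSet G T) {L K : Set V}
    (hL : ∀ s ∈ L, (G.neighborSet s).Subsingleton) (hKL : Disjoint K L) (hK : 2 ≤ K.ncard) :
    2 + L.ncard ≤ T.ncard := by
  have hLT : L ⊆ T := fun s hs => hT.mem_of_subsingleton_neighborSet (hL s hs)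
  have hdiff : 2 ≤ (T \ L).ncard := by
    by_contra hlt
    have hsub : (T \ L).Subsingleton := Set.ncard_le_one_iff_subsingleton.1 (by omega)
    have huniv : T = Set.univ :=
      (ccHull_eq_self (ccConvex_of_subsingleton_diff hL hsub)).symm.trans hT
    have hKT : K ⊆ T \ L := fun k hk => ⟨huniv ▸ Set.mem_univ k, hKL.notMem_of_mem_left hk⟩
    exact hlt (hK.trans (Set.ncard_le_ncard hKT))
  have := Set.ncard_sdiff_add_ncard_of_subset hLT
  omega

/-- If `K` is a clique, the vertices of `L` have degree at most one, and every vertex outside of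
`K` and `L` has two neighbors in `K`, then the hull number is `2 + |L|`. -/
theorem hnCC_eq_two_add_ncard [Finite V] {K L : Set V} (hclique : G.IsClique K)
    (hK : 2 ≤ K.ncard) (hKL : Disjoint K L) (hL : ∀ s ∈ L, (G.neighborSet s).Subsingleton)
    (hout : ∀ v, v ∉ K → v ∉ L → ∃ a ∈ K, ∃ b ∈ K, a ≠ b ∧ G.Adj v a ∧ G.Adj v b) :
    hnCC G = 2 + L.ncard := by
  obtain ⟨k, hk, l, hl, hkl⟩ := (Set.one_lt_ncard).1 hK
  have hcard : ({k, l} ∪ L).ncard = 2 + L.ncard := by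
    rw [Set.ncard_union_eq, Set.ncard_pair hkl]
    exact hKL.mono_left (Set.pair_subset hk hl)
  have hhull : IsHullSet G ({k, l} ∪ L) := by
    refine Set.eq_univ_of_forall fun v => Set.mem_sInter.2 ?_
    rintro U ⟨hU, hconv⟩
    have hkU : k ∈ U := hU (by simp)
    have hlU : l ∈ U := hU (by simp)
    have hKU : K ⊆ U := fun x hx => by
      by_cases hxk : x = k
      · exact hxk ▸ hkU
      by_cases hxl : x = l
      · exact hxl ▸ hlU
      exact hconv.mem_of_triangle hkU hlU (hclique hk hl hkl) (hclique hx hk hxk)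
        (hclique hx hl hxl)
    by_cases hvK : v ∈ K
    · exact hKU hvK
    by_cases hvL : v ∈ L
    · exact hU (Or.inr hvL)
    obtain ⟨a, ha, b, hb, hab, hva, hvb⟩ := hout v hvK hvL
    exact hconv.mem_of_triangle (hKU ha) (hKU hb) (hclique ha hb hab) hva hvb
  refine le_antisymm (Nat.sInf_le ⟨_, hcard, hhull⟩) (le_csInf ⟨_, _, hcard, hhull⟩ ?_)
  rintro _ ⟨T, rfl, hT⟩
  exact hT.two_add_ncard_le hL hKL hK

end CycleConvexity

/-- The hull number of a spider in the cycle convexity is `2` when `|K| ≥ 3` and the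
spider is fat, and `2 + |S|` otherwise. -/
theorem hnCC_spider {V : Type*} [Fintype V] (G : SimpleGraph V) (K S R : Set V)
    (h : IsSpider G K S R) :
    (3 ≤ K.ncard ∧ IsFatSpider G K S → hnCC G = 2) ∧
    (¬ (3 ≤ K.ncard ∧ IsFatSpider G K S) → hnCC G = 2 + S.ncard) := by
  obtain ⟨hcover, hKS, _, _, _, hK, hclique, _, hRK, _, hspider⟩ := h
  have hR : ∀ v, v ∉ K → v ∉ S →
      ∃ a ∈ K, ∃ b ∈ K, a ≠ b ∧ G.Adj v a ∧ G.Adj v b := by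
    intro v hvK hvS
    have hvR : v ∈ R := by
      have hv : v ∈ K ∪ S ∪ R := hcover ▸ Set.mem_univ v
      exact hv.resolve_left (not_or.2 ⟨hvK, hvS⟩)
    obtain ⟨a, ha, b, hb, hab⟩ := (Set.one_lt_ncard).1 hK
    exact ⟨a, ha, b, hb, hab, hRK v hvR a ha, hRK v hvR b hb⟩
  constructor
  · rintro ⟨hK3, f, hf, hN⟩
    rw [hnCC_eq_two_add_ncard hclique hK (Set.disjoint_empty K) (by simp), Set.ncard_empty]
    intro v hvK _
    by_cases hvS : v ∈ S
    · have h2 : 1 < (K \ {f v}).ncard := by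
        rw [Set.ncard_sdiff_singleton_of_mem (hf.mapsTo hvS)]
        omega
      obtain ⟨a, ha, b, hb, hab⟩ := (Set.one_lt_ncard).1 h2
      exact ⟨a, ha.1, b, hb.1, hab, (hN v hvS).ge ha, (hN v hvS).ge hb⟩
    · exact hR v hvK hvS
  · intro hnot
    refine hnCC_eq_two_add_ncard hclique hK hKS (fun s hs => ?_) hR
    rcases hspider with ⟨f, -, hN⟩ | ⟨f, hf, hN⟩
    · rw [hN s hs]
      exact Set.subsingleton_singleton
    · have hK2 : K.ncard < 3 := not_le.1 fun h3 => hnot ⟨h3, f, hf, hN⟩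
      rw [hN s hs, ← Set.ncard_le_one_iff_subsingleton,
        Set.ncard_sdiff_singleton_of_mem (hf.mapsTo hs)]
      omega
end
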